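/- arXiv:2310.03939 — 3 statements merged into one kernel-verified Lean document; each statement's English description precedes it below -/
import Mathlib

section
/- Let n ≥ 2 and let f : ℝⁿ → [0,∞] be Lebesgue measurable and positively homogeneous of degree −n on the open positive orthant, i.e. f(λz) = λ^{−n} f(z) for every λ > 0 and every z ∈ ℝⁿ with all coordinates positive. Then the two Lebesgue integrals (with values in [0,∞]) ∫_{Δ} f(y₁,…,y_{n−1}, 1−(y₁+…+y_{n−1})) dy over the open simplex Δ = {y ∈ (0,∞)^{n−1} : y₁+…+y_{n−1} < 1} and ∫_{(0,∞)^{n−1}} f(y₁,…,y_{n−1}, 1) dy are equal. -/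
open MeasureTheory ENNReal

section ProjectiveChart

variable {E : Type*} [NormedAddCommGroup E] [NormedSpace ℝ E]

theorem hasFDerivAt_inv_one_sub_smul (L : E →L[ℝ] ℝ) {y : E} (hy : 1 - L y ≠ 0) :
    HasFDerivAt (fun x => (1 - L x)⁻¹ • x)
      ((1 - L y)⁻¹ • (ContinuousLinearMap.id ℝ E + L.smulRight ((1 - L y)⁻¹ • y))) y := by
  have h1 : HasFDerivAt (fun x => 1 - L x) (-L) y := L.hasFDerivAt.const_sub 1
  have h2 := (hasDerivAt_inv hy).comp_hasFDerivAt y h1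
  refine (h2.smul (hasFDerivAt_id y)).congr_fderiv ?_
  ext v
  simp [smul_smul, pow_two, mul_comm, mul_left_comm]

theorem det_smul_id_add_smulRight [FiniteDimensional ℝ E] (c : ℝ) (L : E →L[ℝ] ℝ) (v : E) :
    (c • (ContinuousLinearMap.id ℝ E + L.smulRight v)).det =
      c ^ Module.finrank ℝ E * (1 + L v) := by
  have h : ((c • (ContinuousLinearMap.id ℝ E + L.smulRight v) : E →L[ℝ] E) : E →ₗ[ℝ] E) =
      c • LinearMap.transvection (L : E →ₗ[ℝ] ℝ) v := by
    ext x
    simp [LinearMap.transvection.apply]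
  rw [ContinuousLinearMap.det, h, LinearMap.det_smul, LinearMap.transvection.det]
  simp

theorem inv_one_add_smul_inv_one_sub_smul (L : E →L[ℝ] ℝ) {y : E} (hy : 1 - L y ≠ 0) :
    (1 + L ((1 - L y)⁻¹ • y))⁻¹ • (1 - L y)⁻¹ • y = y := by
  have h : 1 + L ((1 - L y)⁻¹ • y) = (1 - L y)⁻¹ := by
    rw [map_smul, smul_eq_mul]
    field_simp
    ring
  rw [h, inv_inv, smul_inv_smul₀ hy]

theorem inv_one_sub_smul_inv_one_add_smul (L : E →L[ℝ] ℝ) {y : E} (hy : 1 + L y ≠ 0) :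
    (1 - L ((1 + L y)⁻¹ • y))⁻¹ • (1 + L y)⁻¹ • y = y := by
  simpa [← sub_eq_add_neg] using inv_one_add_smul_inv_one_sub_smul (-L) (y := y) (by simpa using hy)

end ProjectiveChart

/-- Scalar form of the projective-equivalence theorem (Cheng–Wu):
for `n = m + 1 ≥ 2` and a measurable `f : ℝⁿ → [0,∞]` which is positively
homogeneous of degree `−n` on the open positive orthant, the integral of
`f(y₁,…,y_m, 1 − Σ yᵢ)` over the open simplex equals the integral of
`f(y₁,…,y_m, 1)` over the open positive orthant of `ℝ^m`. -/
theorem cheng_wu (m : ℕ) (hm : 1 ≤ m) (f : (Fin (m + 1) → ℝ) → ℝ≥0∞)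
    (hf : Measurable f)
    (hhom : ∀ l : ℝ, 0 < l → ∀ z : Fin (m + 1) → ℝ, (∀ i, 0 < z i) →
      f (l • z) = ENNReal.ofReal (l ^ (-((m : ℝ) + 1))) * f z) :
    ∫⁻ y in {y : Fin m → ℝ | (∀ i, 0 < y i) ∧ ∑ i, y i < 1},
        f (Fin.snoc y (1 - ∑ i, y i)) ∂volume
      = ∫⁻ y in {y : Fin m → ℝ | ∀ i, 0 < y i}, f (Fin.snoc y 1) ∂volume := by
  let L : (Fin m → ℝ) →L[ℝ] ℝ := ∑ i, ContinuousLinearMap.proj i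
  have hL (y : Fin m → ℝ) : L y = ∑ i, y i := by simp [L]
  simp only [← hL]
  set s : Set (Fin m → ℝ) := {y | (∀ i, 0 < y i) ∧ L y < 1}
  have hs : MeasurableSet s := by
    have hpi : MeasurableSet (Set.univ.pi fun _ : Fin m => Set.Ioi (0 : ℝ)) :=
      .univ_pi fun _ => measurableSet_Ioi
    convert hpi.inter (measurableSet_lt L.measurable (measurable_const (a := (1 : ℝ)))) using 1
    ext y
    simp [s]
  have hpos {y} (hy : y ∈ s) : 0 < 1 - L y := sub_pos.2 hy.2
  have himage : (fun y => (1 - L y)⁻¹ • y) '' s = {y : Fin m → ℝ | ∀ i, 0 < y i} := by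
    ext w
    constructor
    · rintro ⟨y, hy, rfl⟩ i
      exact mul_pos (inv_pos.2 (hpos hy)) (hy.1 i)
    · intro hw
      have hLw : 0 ≤ L w := hL w ▸ Finset.sum_nonneg fun i _ => (hw i).le
      have hw1 : 0 < 1 + L w := by linarith
      refine ⟨(1 + L w)⁻¹ • w, ⟨fun i => mul_pos (inv_pos.2 hw1) (hw i), ?_⟩,
        inv_one_sub_smul_inv_one_add_smul L hw1.ne'⟩
      rw [map_smul, smul_eq_mul, inv_mul_lt_one₀ hw1]
      linarith
  have hinj : Set.InjOn (fun y => (1 - L y)⁻¹ • y) s :=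
    Set.LeftInvOn.injOn (f₁' := fun w => (1 + L w)⁻¹ • w)
      fun y hy => inv_one_add_smul_inv_one_sub_smul L (hpos hy).ne'
  rw [← himage, lintegral_image_eq_lintegral_abs_det_fderiv_mul volume hs
    (fun y hy => (hasFDerivAt_inv_one_sub_smul L (hpos hy).ne').hasFDerivWithinAt) hinj]
  refine setLIntegral_congr_fun hs fun y hy => ?_
  have ht := hpos hy
  have hz : ∀ i, 0 < (Fin.snoc y (1 - L y) : Fin (m + 1) → ℝ) i := by
    intro i
    refine Fin.lastCases ?_ (fun j => ?_) i
    · simpa using ht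
    · simpa using hy.1 j
  have hsnoc : (Fin.snoc ((1 - L y)⁻¹ • y) 1 : Fin (m + 1) → ℝ) =
      (1 - L y)⁻¹ • (Fin.snoc y (1 - L y) : Fin (m + 1) → ℝ) := by
    ext i
    refine Fin.lastCases ?_ (fun j => ?_) i
    · simp [ht.ne']
    · simp
  have hdet : (1 - L y)⁻¹ ^ m * (1 + L ((1 - L y)⁻¹ • y)) = (1 - L y)⁻¹ ^ (m + 1) := by
    rw [map_smul, smul_eq_mul, pow_succ]
    congr 1
    field_simp
    ring
  have hrpow : (1 - L y)⁻¹ ^ (-((m : ℝ) + 1)) = (1 - L y) ^ (m + 1) := by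
    rw [Real.inv_rpow ht.le, Real.rpow_neg ht.le, inv_inv]
    exact_mod_cast Real.rpow_natCast (1 - L y) (m + 1)
  rw [det_smul_id_add_smulRight, Module.finrank_fin_fun, hdet, hsnoc,
    hhom _ (inv_pos.2 ht) _ hz, hrpow, abs_of_pos (by positivity), ← mul_assoc,
    ← ENNReal.ofReal_mul (by positivity), ← mul_pow, inv_mul_cancel₀ ht.ne', one_pow,
    ENNReal.ofReal_one, one_mul]
end

section
/- Fix r > 0 and ε ∈ (−1,0). On the open simplex Δ = {(z₁,z₂,z₃) ∈ (0,∞)³ : z₁+z₂+z₃ < 1}, with z₄ := 1−z₁−z₂−z₃ and F := r·z₁z₃ + z₂z₄ > 0, the functions z₁²z₃²·F^{−(4+ε)}, z₁z₃·F^{−(3+ε)} and z₁²z₃·F^{−(3+ε)} are Lebesgue integrable on Δ, and (3+ε)·r·∫_Δ z₁²z₃² F^{−(4+ε)} = 2·∫_Δ z₁z₃ F^{−(3+ε)} + 2ε·∫_Δ z₁²z₃ F^{−(3+ε)}. -/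
open MeasureTheory

noncomputable section

/-- The open simplex `Δ = {(z₁,z₂,z₃) ∈ (0,∞)³ : z₁+z₂+z₃ < 1}`. -/
def boxDelta : Set (ℝ × ℝ × ℝ) :=
  {z | 0 < z.1 ∧ 0 < z.2.1 ∧ 0 < z.2.2 ∧ z.1 + z.2.1 + z.2.2 < 1}

/-- The fourth Feynman parameter `z₄ = 1 − z₁ − z₂ − z₃`. -/
def boxZ4 (z : ℝ × ℝ × ℝ) : ℝ := 1 - z.1 - z.2.1 - z.2.2

/-- The second Symanzik polynomial of the massless box, `F = r z₁ z₃ + z₂ z₄`. -/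
def boxF (r : ℝ) (z : ℝ × ℝ × ℝ) : ℝ := r * z.1 * z.2.2 + z.2.1 * boxZ4 z

end

theorem isOpen_boxDelta : IsOpen boxDelta := by
  simp only [boxDelta, Set.ofPred_and]
  exact (isOpen_lt (by fun_prop) (by fun_prop)).inter
    ((isOpen_lt (by fun_prop) (by fun_prop)).inter
      ((isOpen_lt (by fun_prop) (by fun_prop)).inter (isOpen_lt (by fun_prop) (by fun_prop))))

theorem continuous_boxF (r : ℝ) : Continuous (boxF r) := by
  unfold boxF boxZ4
  fun_prop

theorem boxZ4_pos {z : ℝ × ℝ × ℝ} (hz : z ∈ boxDelta) : 0 < boxZ4 z := by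
  obtain ⟨-, -, -, h⟩ := hz
  unfold boxZ4
  linarith

theorem boxF_pos {r : ℝ} (hr : 0 < r) {z : ℝ × ℝ × ℝ} (hz : z ∈ boxDelta) : 0 < boxF r z := by
  have h4 := boxZ4_pos hz
  obtain ⟨h1, h2, h3, -⟩ := hz
  unfold boxF
  positivity

/-- Exchanging `z₃` and `z₄` preserves Lebesgue measure. -/
theorem measurePreserving_boxZ4 :
    MeasurePreserving (fun z : ℝ × ℝ × ℝ => (z.1, z.2.1, boxZ4 z)) := by
  have h : ∀ x : ℝ, MeasurePreserving (fun v : ℝ × ℝ => (v.1, 1 - x - v.1 - v.2)) := fun x =>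
    (MeasurePreserving.id volume).skew_product (g := fun y w : ℝ => 1 - x - y - w)
      (by unfold Function.uncurry; fun_prop)
      (Filter.Eventually.of_forall fun y => (Measure.measurePreserving_sub_left volume _).map_eq)
  exact (MeasurePreserving.id volume).skew_product
    (g := fun (x : ℝ) (v : ℝ × ℝ) => (v.1, 1 - x - v.1 - v.2))
    (by unfold Function.uncurry; fun_prop)
    (Filter.Eventually.of_forall fun x => (h x).map_eq)

/-- The cyclic permutation of the coordinates preserves Lebesgue measure. -/
theorem measurePreserving_cyclic :
    MeasurePreserving (fun z : ℝ × ℝ × ℝ => (z.2.1, z.2.2, z.1)) :=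
  (volume_preserving_prodAssoc (α₁ := ℝ) (β₁ := ℝ) (γ₁ := ℝ)).comp
    (Measure.measurePreserving_swap (μ := (volume : Measure ℝ)) (ν := (volume : Measure (ℝ × ℝ))))

/-- The function `t ^ (-q)` cut off to the unit interval. -/
noncomputable def unitRpow (q t : ℝ) : ℝ := (Set.Ioo (0 : ℝ) 1).indicator (fun t => t ^ (-q)) t

theorem unitRpow_nonneg (q t : ℝ) : 0 ≤ unitRpow q t :=
  Set.indicator_nonneg (fun _ ht => Real.rpow_nonneg ht.1.le _) t

theorem unitRpow_of_mem {q t : ℝ} (h0 : 0 < t) (h1 : t < 1) : unitRpow q t = t ^ (-q) :=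
  Set.indicator_of_mem (s := Set.Ioo (0 : ℝ) 1) ⟨h0, h1⟩ _

theorem integrable_unitRpow {q : ℝ} (hq : q < 1) : Integrable (unitRpow q) := by
  have h : IntervalIntegrable (fun t : ℝ => t ^ (-q)) volume 0 1 :=
    intervalIntegral.intervalIntegrable_rpow' (by linarith)
  rw [intervalIntegrable_iff_integrableOn_Ioo_of_le zero_le_one] at h
  exact (integrable_indicator_iff measurableSet_Ioo).2 h

theorem rpow_le_unitRpow_mul {r q a b c d F : ℝ} (hr : 0 < r) (hq : 0 < q)
    (ha : 0 < a) (hb : 0 < b) (hc : 0 < c) (ha' : a < 1) (hb' : b < 1) (hc' : c < 1)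
    (hd : 1 / 4 ≤ d) (hF : 0 < F) (h : 4 * r * (a * b * c * d) ≤ F ^ 2) :
    F ^ (-(2 * q)) ≤ r ^ (-q) * (unitRpow q a * (unitRpow q b * unitRpow q c)) := by
  rw [unitRpow_of_mem ha ha', unitRpow_of_mem hb hb', unitRpow_of_mem hc hc',
    ← Real.mul_rpow hb.le hc.le, ← Real.mul_rpow ha.le (by positivity),
    ← Real.mul_rpow hr.le (by positivity), show -(2 * q) = (2 : ℕ) * (-q) by push_cast; ring,
    Real.rpow_mul hF.le, Real.rpow_natCast]
  refine Real.rpow_le_rpow_of_nonpos (by positivity) ?_ (by linarith)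
  have : 0 < r * (a * (b * c)) := by positivity
  nlinarith

theorem integrableOn_boxF_rpow {r p : ℝ} (hr : 0 < r) (hp : 0 < p) (hp2 : p < 2) :
    IntegrableOn (fun z => boxF r z ^ (-p)) boxDelta := by
  obtain ⟨q, rfl⟩ : ∃ q, p = 2 * q := ⟨p / 2, by ring⟩
  have hκ := integrable_unitRpow (show q < 1 by linarith)
  set K : ℝ × ℝ × ℝ → ℝ := fun z => unitRpow q z.1 * (unitRpow q z.2.1 * unitRpow q z.2.2)
  have hK : Integrable K := hκ.mul_prod (hκ.mul_prod hκ)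
  have hK0 : ∀ z, 0 ≤ K z := fun z =>
    mul_nonneg (unitRpow_nonneg _ _) (mul_nonneg (unitRpow_nonneg _ _) (unitRpow_nonneg _ _))
  have h1 := measurePreserving_boxZ4.integrable_comp_of_integrable hK
  have h2 := measurePreserving_cyclic.integrable_comp_of_integrable h1
  have h3 := measurePreserving_cyclic.integrable_comp_of_integrable h2
  have hsum := (((hK.add h1).add h2).add h3).const_mul (r ^ (-q))
  refine Integrable.mono' (hsum.integrableOn (s := boxDelta)) ?_ ?_
  · exact ((continuous_boxF r).measurable.pow_const _).aestronglyMeasurable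
  · refine (ae_restrict_iff' isOpen_boxDelta.measurableSet).2 (Filter.Eventually.of_forall ?_)
    intro z hz
    have hF := boxF_pos hr hz
    rw [Real.norm_of_nonneg (Real.rpow_nonneg hF.le _)]
    have h4 := boxZ4_pos hz
    have hamgm : 4 * r * (z.1 * z.2.1 * z.2.2 * boxZ4 z) ≤ boxF r z ^ 2 := by
      unfold boxF
      nlinarith [sq_nonneg (r * z.1 * z.2.2 - z.2.1 * boxZ4 z)]
    have hsum1 : z.1 + z.2.1 + z.2.2 + boxZ4 z = 1 := by unfold boxZ4; ring
    have e2 : boxZ4 (z.2.1, z.2.2, z.1) = boxZ4 z := by simp only [boxZ4]; ring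
    have e3 : boxZ4 (z.2.2, z.1, z.2.1) = boxZ4 z := by simp only [boxZ4]; ring
    obtain ⟨x, y, w⟩ := z
    obtain ⟨hx, hy, hw, -⟩ := hz
    have k0 := hK0 (x, y, w)
    have k1 := hK0 (x, y, boxZ4 (x, y, w))
    have k2 := hK0 (y, w, boxZ4 (x, y, w))
    have k3 := hK0 (w, x, boxZ4 (x, y, w))
    simp only [Pi.add_apply, Function.comp_apply] at e2 e3 hx hy hw hamgm hsum1 ⊢
    rw [e2, e3]
    have hR : 0 < r ^ (-q) := Real.rpow_pos_of_pos hr _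
    generalize boxZ4 (x, y, w) = v at *
    have hq : 0 < q := by linarith
    have hcases : 1 / 4 ≤ v ∨ 1 / 4 ≤ w ∨ 1 / 4 ≤ x ∨ 1 / 4 ≤ y := by
      by_contra! hcon
      linarith
    rcases hcases with hd | hd | hd | hd
    · refine (rpow_le_unitRpow_mul hr hq hx hy hw (by linarith) (by linarith) (by linarith) hd hF
        (by linarith)).trans (mul_le_mul_of_nonneg_left ?_ hR.le)
      change K (x, y, w) ≤ _
      linarith
    · refine (rpow_le_unitRpow_mul hr hq hx hy h4 (by linarith) (by linarith) (by linarith) hd hF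
        (by linarith)).trans (mul_le_mul_of_nonneg_left ?_ hR.le)
      change K (x, y, v) ≤ _
      linarith
    · refine (rpow_le_unitRpow_mul hr hq hy hw h4 (by linarith) (by linarith) (by linarith) hd hF
        (by linarith)).trans (mul_le_mul_of_nonneg_left ?_ hR.le)
      change K (y, w, v) ≤ _
      linarith
    · refine (rpow_le_unitRpow_mul hr hq hw hx h4 (by linarith) (by linarith) (by linarith) hd hF
        (by linarith)).trans (mul_le_mul_of_nonneg_left ?_ hR.le)
      change K (w, x, v) ≤ _
      linarith

/-- A bounded power of `z₁ z₃ / F` may be traded for a power of `F`. -/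
theorem integrableOn_mul_boxF_rpow {r p : ℝ} (hr : 0 < r) (hp : 0 < p) (hp2 : p < 2) (n : ℕ)
    {φ : ℝ × ℝ × ℝ → ℝ} (hφ : Measurable φ) (hφ0 : ∀ z ∈ boxDelta, 0 ≤ φ z)
    (hφ1 : ∀ z ∈ boxDelta, φ z ≤ (z.1 * z.2.2) ^ n) :
    IntegrableOn (fun z => φ z * boxF r z ^ (-(n + p))) boxDelta := by
  refine Integrable.mono' ((integrableOn_boxF_rpow hr hp hp2).const_mul ((r⁻¹) ^ n)) ?_ ?_
  · exact (hφ.mul ((continuous_boxF r).measurable.pow_const _)).aestronglyMeasurable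
  · refine (ae_restrict_iff' isOpen_boxDelta.measurableSet).2 (Filter.Eventually.of_forall ?_)
    intro z hz
    have hF := boxF_pos hr hz
    rw [Real.norm_of_nonneg (mul_nonneg (hφ0 z hz) (Real.rpow_nonneg hF.le _)),
      neg_add, Real.rpow_add hF, ← mul_assoc, Real.rpow_neg hF.le, Real.rpow_natCast]
    refine mul_le_mul_of_nonneg_right ?_ (Real.rpow_nonneg hF.le _)
    rw [← div_eq_mul_inv, div_le_iff₀ (by positivity), ← mul_pow]
    have h4 := boxZ4_pos hz
    refine (hφ1 z hz).trans (pow_le_pow_left₀ ?_ ?_ n)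
    · obtain ⟨h1, -, h3, -⟩ := hz
      positivity
    · obtain ⟨h1, h2, h3, -⟩ := hz
      rw [inv_mul_eq_div, le_div_iff₀ hr]
      unfold boxF
      nlinarith [mul_pos h2 h4]

theorem integral_sq_mul_comp_smul (f : ℝ × ℝ → ℝ) {ρ : ℝ} (hρ : ρ ≠ 0) :
    ∫ u, ρ ^ 2 * f (ρ • u) = ∫ v, f v := by
  rw [integral_const_mul, Measure.integral_comp_smul, Module.finrank_prod, Module.finrank_self,
    one_add_one_eq_two, abs_of_nonneg (by positivity), smul_eq_mul, ← mul_assoc,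
    mul_inv_cancel₀ (by positivity), one_mul]

theorem integrable_cone {g : ℝ × ℝ × ℝ → ℝ} (hm : Measurable g) (hg : Integrable g) :
    Integrable (fun z : ℝ × ℝ × ℝ => (1 - z.1) ^ 2 * g (z.1, (1 - z.1) • z.2)) := by
  have hk : Measurable (fun z : ℝ × ℝ × ℝ => (1 - z.1) ^ 2 * g (z.1, (1 - z.1) • z.2)) := by
    fun_prop
  have h1 : ∀ᵐ x : ℝ, x ≠ 1 := Measure.ae_ne volume 1
  obtain ⟨ha, hb⟩ := (integrable_prod_iff hg.aestronglyMeasurable).1 hg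
  refine (integrable_prod_iff hk.aestronglyMeasurable).2 ⟨?_, hb.congr ?_⟩
  · filter_upwards [h1, ha] with x hx hx'
    exact ((integrable_comp_smul_iff volume (fun v => g (x, v)) (sub_ne_zero.2 hx.symm)).2
      hx').const_mul _
  · filter_upwards [h1] with x hx
    rw [← integral_sq_mul_comp_smul (fun v => ‖g (x, v)‖) (sub_ne_zero.2 hx.symm)]
    simp only [norm_mul, norm_pow, Real.norm_eq_abs, sq_abs]

/-- Integration along the rays through the vertex `(1, 0, 0)`. -/
theorem integral_cone {g : ℝ × ℝ × ℝ → ℝ} (hm : Measurable g) (hg : Integrable g) :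
    ∫ z, g z = ∫ u : ℝ × ℝ, ∫ x : ℝ, (1 - x) ^ 2 * g (x, (1 - x) • u) := by
  rw [← integral_prod_symm _ (integrable_cone hm hg),
    ← Measure.volume_eq_prod, Measure.volume_eq_prod, integral_prod _ (integrable_cone hm hg),
    integral_prod _ hg]
  refine integral_congr_ae ?_
  filter_upwards [Measure.ae_ne volume (1 : ℝ)] with x hx
  exact (integral_sq_mul_comp_smul (fun v => g (x, v)) (sub_ne_zero.2 hx.symm)).symm

theorem boxF_ray (r x b c : ℝ) :
    boxF r (x, (1 - x) • (b, c)) = (1 - x) * (r * x * c + (1 - x) * (b * (1 - b - c))) := by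
  simp only [boxF, boxZ4, Prod.smul_mk, smul_eq_mul]
  ring

theorem ray_mem_boxDelta_iff {x : ℝ} {u : ℝ × ℝ} :
    (x, (1 - x) • u) ∈ boxDelta ↔ x ∈ Set.Ioo 0 1 ∧ 0 < u.1 ∧ 0 < u.2 ∧ u.1 + u.2 < 1 := by
  obtain ⟨b, c⟩ := u
  simp only [boxDelta, Set.mem_ofPred_eq, Prod.smul_mk, smul_eq_mul, Set.mem_Ioo]
  constructor
  · rintro ⟨h1, h2, h3, h4⟩
    have hx : 0 < 1 - x := by linarith
    refine ⟨⟨h1, by linarith⟩, pos_of_mul_pos_right h2 hx.le, pos_of_mul_pos_right h3 hx.le, ?_⟩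
    by_contra! hbc
    nlinarith
  · rintro ⟨⟨h1, h2⟩, hb, hc, hbc⟩
    have hx : 0 < 1 - x := by linarith
    exact ⟨h1, by positivity, by positivity, by nlinarith⟩

/-- The divergence of `z₁² z₃ F ^ (-(3 + ε))` times the projective vector field `∂/∂z₁`. -/
noncomputable def boxDiv (r ε : ℝ) (z : ℝ × ℝ × ℝ) : ℝ :=
  2 * (z.1 * z.2.2 * boxF r z ^ (-(3 + ε))) + 2 * ε * (z.1 ^ 2 * z.2.2 * boxF r z ^ (-(3 + ε)))
    - (3 + ε) * r * (z.1 ^ 2 * z.2.2 ^ 2 * boxF r z ^ (-(4 + ε)))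

theorem hasDerivAt_boxDiv_ray {r ε x b c : ℝ} (hF : 0 < boxF r (x, (1 - x) • (b, c))) :
    HasDerivAt (fun x => x ^ 2 * c * (1 - x) ^ 4 * boxF r (x, (1 - x) • (b, c)) ^ (-(3 + ε)))
      ((1 - x) ^ 2 * boxDiv r ε (x, (1 - x) • (b, c))) x := by
  have hρ : HasDerivAt (fun x : ℝ => 1 - x) (-1) x := by
    simpa using (hasDerivAt_id x).const_sub 1
  have hFd : HasDerivAt (fun x => boxF r (x, (1 - x) • (b, c)))
      (-1 * (r * x * c + (1 - x) * (b * (1 - b - c)))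
        + (1 - x) * (r * c + -1 * (b * (1 - b - c)))) x := by
    simp only [boxF_ray]
    refine hρ.mul (HasDerivAt.add ?_ (hρ.mul_const _))
    simpa using ((hasDerivAt_id x).const_mul r).mul_const c
  have h := (((((hasDerivAt_id x).pow 2).mul_const c).mul (hρ.pow 4))).mul
    (hFd.rpow_const (p := -(3 + ε)) (Or.inl hF.ne'))
  convert! h using 1
  have e1 : boxF r (x, (1 - x) • (b, c)) ^ (-(3 + ε)) =
      boxF r (x, (1 - x) • (b, c)) ^ (-(4 + ε)) * boxF r (x, (1 - x) • (b, c)) := by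
    rw [← Real.rpow_add_one hF.ne']
    congr 1
    ring
  simp only [boxDiv, e1, show -(3 + ε) - 1 = -(4 + ε) by ring, id, Pi.pow_apply, Pi.mul_apply]
  generalize boxF r (x, (1 - x) • (b, c)) ^ (-(4 + ε)) = A
  rw [boxF_ray]
  simp only [Prod.smul_mk, smul_eq_mul]
  push_cast
  ring

theorem integral_boxDiv_ray {r ε b c : ℝ} (hr : 0 < r) (hε : ε < 0) (hb : 0 < b) (hc : 0 < c)
    (hbc : b + c < 1)
    (hint : IntegrableOn (fun x => (1 - x) ^ 2 * boxDiv r ε (x, (1 - x) • (b, c)))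
      (Set.Ioo 0 1)) :
    ∫ x in Set.Ioo 0 1, (1 - x) ^ 2 * boxDiv r ε (x, (1 - x) • (b, c)) = 0 := by
  have hd : 0 < b * (1 - b - c) := mul_pos hb (by linarith)
  have hQ : ∀ x ∈ Set.Icc (0 : ℝ) 1, 0 < r * x * c + (1 - x) * (b * (1 - b - c)) := by
    rintro x ⟨h0, h1⟩
    rcases h0.eq_or_lt with rfl | h0
    · simpa using hd
    · have := mul_nonneg (sub_nonneg.2 h1) hd.le
      have : 0 < r * x * c := by positivity
      linarith
  have hF : ∀ x ∈ Set.Ioo (0 : ℝ) 1, 0 < boxF r (x, (1 - x) • (b, c)) := fun x hx => by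
    rw [boxF_ray]
    exact mul_pos (sub_pos.2 hx.2) (hQ x ⟨hx.1.le, hx.2.le⟩)
  rw [← integral_Ioc_eq_integral_Ioo, ← intervalIntegral.integral_of_le zero_le_one,
    intervalIntegral.integral_eq_sub_of_hasDerivAt_of_tendsto (fa := 0) (fb := 0) zero_lt_one
    (fun x hx => hasDerivAt_boxDiv_ray (hF x hx))
    ((intervalIntegrable_iff_integrableOn_Ioo_of_le zero_le_one).2 hint) ?_ ?_, sub_zero]
  · have hcont : ContinuousAt
        (fun x => x ^ 2 * c * (1 - x) ^ 4 * boxF r (x, (1 - x) • (b, c)) ^ (-(3 + ε))) 0 := by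
      refine ContinuousAt.mul (by fun_prop) (ContinuousAt.rpow_const ?_ (Or.inl ?_))
      · simp only [boxF_ray]
        fun_prop
      · rw [boxF_ray]
        simpa using ⟨hb.ne', by linarith⟩
    simpa using hcont.tendsto.mono_left nhdsWithin_le_nhds
  · have hcont : ContinuousAt (fun x => x ^ 2 * c * (1 - x) ^ (1 - ε) *
        (r * x * c + (1 - x) * (b * (1 - b - c))) ^ (-(3 + ε))) 1 := by
      refine ContinuousAt.mul (ContinuousAt.mul (by fun_prop) ?_) (ContinuousAt.rpow_const
        (by fun_prop) (Or.inl (hQ 1 ⟨zero_le_one, le_rfl⟩).ne'))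
      exact ContinuousAt.rpow_const (by fun_prop) (Or.inr (by linarith))
    have hlim := hcont.tendsto.mono_left (nhdsWithin_le_nhds (s := Set.Iio 1))
    rw [sub_self, Real.zero_rpow (by linarith), mul_zero, zero_mul] at hlim
    refine hlim.congr' ?_
    filter_upwards [Ioo_mem_nhdsLT (zero_lt_one (α := ℝ))] with x hx
    have hρ : 0 < 1 - x := sub_pos.2 hx.2
    rw [boxF_ray, Real.mul_rpow hρ.le (hQ x ⟨hx.1.le, hx.2.le⟩).le,
      show 1 - ε = (4 : ℕ) + -(3 + ε) by push_cast; ring, Real.rpow_add hρ, Real.rpow_natCast]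
    ring

theorem integral_boxDiv {r ε : ℝ} (hr : 0 < r) (hε : ε < 0)
    (hint : IntegrableOn (boxDiv r ε) boxDelta) : ∫ z in boxDelta, boxDiv r ε z = 0 := by
  have hmF := (continuous_boxF r).measurable
  have hm : Measurable (boxDelta.indicator (boxDiv r ε)) := by
    refine Measurable.indicator ?_ isOpen_boxDelta.measurableSet
    unfold boxDiv
    fun_prop
  have hg := (integrable_indicator_iff isOpen_boxDelta.measurableSet).2 hint
  rw [← integral_indicator isOpen_boxDelta.measurableSet, integral_cone hm hg]
  refine integral_eq_zero_of_ae ?_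
  filter_upwards [(integrable_cone hm hg).prod_left_ae] with u hu
  by_cases h : 0 < u.1 ∧ 0 < u.2 ∧ u.1 + u.2 < 1
  · have hray : (fun x : ℝ => (1 - x) ^ 2 * boxDelta.indicator (boxDiv r ε) (x, (1 - x) • u)) =
        (Set.Ioo 0 1).indicator (fun x => (1 - x) ^ 2 * boxDiv r ε (x, (1 - x) • u)) := by
      ext x
      by_cases hx : x ∈ Set.Ioo (0 : ℝ) 1
      · rw [Set.indicator_of_mem hx, Set.indicator_of_mem (ray_mem_boxDelta_iff.2 ⟨hx, h⟩)]
      · rw [Set.indicator_of_notMem hx,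
          Set.indicator_of_notMem (fun h' => hx (ray_mem_boxDelta_iff.1 h').1), mul_zero]
    simp only [hray] at hu ⊢
    rw [integral_indicator measurableSet_Ioo]
    exact integral_boxDiv_ray hr hε h.1 h.2.1 h.2.2
      ((integrable_indicator_iff measurableSet_Ioo).1 hu)
  · have hray : ∀ x : ℝ, (x, (1 - x) • u) ∉ boxDelta := fun x hx =>
      h (ray_mem_boxDelta_iff.1 hx).2
    simp [Set.indicator_of_notMem (hray _)]

/-- IBP identity `(3+ε) r I(3,1,3,1;2ε) = 2 I(2,1,2,1;2ε) + 2ε I(3,1,2,1;−1+2ε)`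
for the one-loop massless box, in Feynman parameter space. -/
theorem box_ibp_3131 (r ε : ℝ) (hr : 0 < r) (hε : ε ∈ Set.Ioo (-1 : ℝ) 0) :
    IntegrableOn (fun z => z.1 ^ 2 * z.2.2 ^ 2 * boxF r z ^ (-(4 + ε))) boxDelta volume ∧
    IntegrableOn (fun z => z.1 * z.2.2 * boxF r z ^ (-(3 + ε))) boxDelta volume ∧
    IntegrableOn (fun z => z.1 ^ 2 * z.2.2 * boxF r z ^ (-(3 + ε))) boxDelta volume ∧
    (3 + ε) * r * ∫ z in boxDelta, z.1 ^ 2 * z.2.2 ^ 2 * boxF r z ^ (-(4 + ε)) =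
      2 * (∫ z in boxDelta, z.1 * z.2.2 * boxF r z ^ (-(3 + ε)))
        + 2 * ε * ∫ z in boxDelta, z.1 ^ 2 * z.2.2 * boxF r z ^ (-(3 + ε)) := by
  obtain ⟨hε1, hε0⟩ := hε
  have hle : ∀ z ∈ boxDelta, 0 < z.1 ∧ z.1 < 1 ∧ 0 < z.2.2 := fun z ⟨h1, h2, h3, h4⟩ =>
    ⟨h1, by linarith, h3⟩
  have i1 : IntegrableOn (fun z => z.1 ^ 2 * z.2.2 ^ 2 * boxF r z ^ (-(4 + ε))) boxDelta := by
    convert! integrableOn_mul_boxF_rpow hr (p := 2 + ε) (by linarith) (by linarith) 2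
      (φ := fun z => z.1 ^ 2 * z.2.2 ^ 2) (by fun_prop) (fun z _ => by positivity)
      (fun z _ => (mul_pow _ _ _).ge) using 5
    push_cast
    ring
  have i2 : IntegrableOn (fun z => z.1 * z.2.2 * boxF r z ^ (-(3 + ε))) boxDelta := by
    convert! integrableOn_mul_boxF_rpow hr (p := 2 + ε) (by linarith) (by linarith) 1
      (φ := fun z => z.1 * z.2.2) (by fun_prop)
      (fun z hz => mul_nonneg (hle z hz).1.le (hle z hz).2.2.le)
      (fun z _ => (pow_one _).ge) using 5
    push_cast
    ring
  have i3 : IntegrableOn (fun z => z.1 ^ 2 * z.2.2 * boxF r z ^ (-(3 + ε))) boxDelta := by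
    convert! integrableOn_mul_boxF_rpow hr (p := 2 + ε) (by linarith) (by linarith) 1
      (φ := fun z => z.1 ^ 2 * z.2.2) (by fun_prop)
      (fun z hz => mul_nonneg (sq_nonneg _) (hle z hz).2.2.le)
      (fun z hz => ?_) using 5
    · push_cast
      ring
    · obtain ⟨h1, h2, h3⟩ := hle z hz
      rw [pow_one]
      exact mul_le_mul_of_nonneg_right (by nlinarith) h3.le
  refine ⟨i1, i2, i3, ?_⟩
  have i23 : IntegrableOn (fun z => 2 * (z.1 * z.2.2 * boxF r z ^ (-(3 + ε)))
      + 2 * ε * (z.1 ^ 2 * z.2.2 * boxF r z ^ (-(3 + ε)))) boxDelta :=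
    (i2.const_mul 2).add (i3.const_mul (2 * ε))
  have h0 := integral_boxDiv hr hε0 (i23.sub (i1.const_mul ((3 + ε) * r)))
  unfold boxDiv at h0
  rw [integral_sub i23 (i1.const_mul _), integral_add (i2.const_mul _) (i3.const_mul _),
    integral_const_mul, integral_const_mul, integral_const_mul] at h0
  linarith
end

section
/- Fix ε ∈ (−1/6, 1/6). On the open simplex T₄ = {(z₁,z₂,z₃,z₄) ∈ (0,∞)⁴ : z₁+z₂+z₃+z₄ < 1}, with z₅ := 1−z₁−z₂−z₃−z₄, U := (z₁+z₂)(z₃+z₄) + z₅(z₁+z₂+z₃+z₄) > 0 and C := z₁z₂z₃ + z₁z₂z₄ + z₁z₃z₄ + z₂z₃z₄ + z₁z₂z₅ + z₂z₃z₅ + z₃z₄z₅ + z₁z₄z₅ > 0, all the integrands below are Lebesgue integrable on T₄ and ∫_{T₄} U^{3ε−1} C^{−(1+2ε)} = 2·∫_{T₄} z₁z₃ U^{3ε−2} C^{−(1+2ε)} + 2·∫_{T₄} z₁z₄ U^{3ε−2} C^{−(1+2ε)} + 4·∫_{T₄} z₁z₅ U^{3ε−2} C^{−(1+2ε)}. 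-/
open MeasureTheory

noncomputable section

/-- The open simplex `T₄ = {(z₁,z₂,z₃,z₄) ∈ (0,∞)⁴ : z₁+z₂+z₃+z₄ < 1}`. -/
def fiveT4 : Set (ℝ × ℝ × ℝ × ℝ) :=
  {z | 0 < z.1 ∧ 0 < z.2.1 ∧ 0 < z.2.2.1 ∧ 0 < z.2.2.2 ∧
    z.1 + z.2.1 + z.2.2.1 + z.2.2.2 < 1}

/-- The fifth Feynman parameter `z₅ = 1 − z₁ − z₂ − z₃ − z₄`. -/
def fiveZ5 (z : ℝ × ℝ × ℝ × ℝ) : ℝ := 1 - z.1 - z.2.1 - z.2.2.1 - z.2.2.2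

/-- The first Symanzik polynomial `U = (z₁+z₂)(z₃+z₄) + z₅(z₁+z₂+z₃+z₄)` of the
two-loop five-edge two-point graph. -/
def fiveU (z : ℝ × ℝ × ℝ × ℝ) : ℝ :=
  (z.1 + z.2.1) * (z.2.2.1 + z.2.2.2) + fiveZ5 z * (z.1 + z.2.1 + z.2.2.1 + z.2.2.2)

/-- The (normalised) second Symanzik polynomial
`C = z₁z₂z₃ + z₁z₂z₄ + z₁z₃z₄ + z₂z₃z₄ + z₁z₂z₅ + z₂z₃z₅ + z₃z₄z₅ + z₁z₄z₅` of the
two-loop five-edge two-point graph. -/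
def fiveC (z : ℝ × ℝ × ℝ × ℝ) : ℝ :=
  z.1 * z.2.1 * z.2.2.1 + z.1 * z.2.1 * z.2.2.2 + z.1 * z.2.2.1 * z.2.2.2 +
    z.2.1 * z.2.2.1 * z.2.2.2 + z.1 * z.2.1 * fiveZ5 z + z.2.1 * z.2.2.1 * fiveZ5 z +
    z.2.2.1 * z.2.2.2 * fiveZ5 z + z.1 * z.2.2.2 * fiveZ5 z

end

section MeasurePreserving

/-- Relabelling `(z₁,z₃) ↔ (z₂,z₄)` of the edges. -/
def fiveSwap (z : ℝ × ℝ × ℝ × ℝ) : ℝ × ℝ × ℝ × ℝ := (z.2.1, z.1, z.2.2.2, z.2.2.1)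

/-- Relabelling `(z₁,z₂) ↔ (z₄,z₃)` of the edges. -/
def fiveRev (z : ℝ × ℝ × ℝ × ℝ) : ℝ × ℝ × ℝ × ℝ := (z.2.2.2, z.2.2.1, z.2.1, z.1)

/-- Replacing the coordinate `z₁` by `z₅`. -/
def fiveShear (z : ℝ × ℝ × ℝ × ℝ) : ℝ × ℝ × ℝ × ℝ := (fiveZ5 z, z.2)

lemma measurePreserving_fiveSwap : MeasurePreserving fiveSwap volume volume := by
  have h := (measurePreserving_prodAssoc (volume : Measure ℝ) (volume : Measure ℝ)
    (volume : Measure (ℝ × ℝ)))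
  have hs : MeasurePreserving (Prod.swap : ℝ × ℝ → ℝ × ℝ) (volume.prod volume)
    (volume.prod volume) := Measure.measurePreserving_swap
  exact (h.comp (hs.prod hs)).comp h.symm

lemma measurePreserving_fiveRev : MeasurePreserving fiveRev volume volume := by
  have h := (measurePreserving_prodAssoc (volume : Measure ℝ) (volume : Measure ℝ)
    (volume : Measure (ℝ × ℝ)))
  have hs : MeasurePreserving (Prod.swap : ℝ × ℝ → ℝ × ℝ) (volume.prod volume)
    (volume.prod volume) := Measure.measurePreserving_swap
  have ht : MeasurePreserving (Prod.swap : (ℝ × ℝ) × (ℝ × ℝ) → (ℝ × ℝ) × (ℝ × ℝ))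
    ((volume.prod volume).prod (volume.prod volume))
    ((volume.prod volume).prod (volume.prod volume)) := Measure.measurePreserving_swap
  exact (h.comp (ht.comp (hs.prod hs))).comp h.symm

lemma measurePreserving_fiveShear : MeasurePreserving fiveShear volume volume := by
  have hskew : MeasurePreserving
      (fun p : (ℝ × ℝ × ℝ) × ℝ => (p.1, (1 - p.1.1 - p.1.2.1 - p.1.2.2) - p.2))
      ((volume : Measure (ℝ × ℝ × ℝ)).prod (volume : Measure ℝ)) (volume.prod volume) := by
    refine (MeasurePreserving.id _).skew_product
      (g := fun (w : ℝ × ℝ × ℝ) (x : ℝ) => (1 - w.1 - w.2.1 - w.2.2) - x) (by fun_prop) ?_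
    exact Filter.Eventually.of_forall fun w => (Measure.measurePreserving_sub_left volume _).map_eq
  have h := (Measure.measurePreserving_swap.comp hskew).comp
    (Measure.measurePreserving_swap (μ := (volume : Measure ℝ))
      (ν := (volume : Measure (ℝ × ℝ × ℝ))))
  have heq : fiveShear = (Prod.swap ∘ fun p : (ℝ × ℝ × ℝ) × ℝ =>
      (p.1, (1 - p.1.1 - p.1.2.1 - p.1.2.2) - p.2)) ∘ Prod.swap := by
    funext z
    refine Prod.ext ?_ rfl
    simp only [fiveShear, fiveZ5, Function.comp_apply, Prod.fst_swap, Prod.snd_swap]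
    ring
  rw [heq]
  exact h

lemma setIntegral_comp_of_involutive {α : Type*} [MeasurableSpace α] {μ : Measure α}
    {σ : α → α} (hσ : MeasurePreserving σ μ μ) (hinv : Function.Involutive σ) {s : Set α}
    (hs : σ ⁻¹' s = s) (f : α → ℝ) : ∫ x in s, f (σ x) ∂μ = ∫ x in s, f x ∂μ := by
  have he : MeasurableEmbedding σ :=
    (MeasurableEquiv.ofInvolutive σ hinv hσ.measurable).measurableEmbedding
  simpa only [hs] using hσ.setIntegral_preimage_emb he f s

lemma integrableOn_comp_of_preimage_eq {α : Type*} [MeasurableSpace α] {μ : Measure α}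
    {σ : α → α} (hσ : MeasurePreserving σ μ μ) {s : Set α} (hms : MeasurableSet s)
    (hs : σ ⁻¹' s = s) {f : α → ℝ} (hf : IntegrableOn f s μ) :
    IntegrableOn (fun x => f (σ x)) s μ := by
  have h := hσ.restrict_preimage hms
  rw [hs] at h
  exact h.integrable_comp_of_integrable hf

lemma setIntegral_add_comp_of_involutive {α : Type*} [MeasurableSpace α] {μ : Measure α}
    {σ : α → α} (hσ : MeasurePreserving σ μ μ) (hinv : Function.Involutive σ) {s : Set α}
    (hms : MeasurableSet s) (hs : σ ⁻¹' s = s) {f : α → ℝ} (hf : IntegrableOn f s μ) :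
    IntegrableOn (fun x => f x + f (σ x)) s μ ∧
      ∫ x in s, (f x + f (σ x)) ∂μ = 2 * ∫ x in s, f x ∂μ := by
  have hfσ := integrableOn_comp_of_preimage_eq hσ hms hs hf
  refine ⟨hf.add hfσ, ?_⟩
  rw [integral_add hf hfσ, setIntegral_comp_of_involutive hσ hinv hs]
  ring

end MeasurePreserving

section Symmetry

lemma fiveSwap_involutive : Function.Involutive fiveSwap := fun _ => rfl

lemma fiveRev_involutive : Function.Involutive fiveRev := fun _ => rfl

lemma preimage_fiveSwap_fiveT4 : fiveSwap ⁻¹' fiveT4 = fiveT4 := by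
  ext z
  simp only [fiveSwap, fiveT4, Set.mem_preimage, Set.mem_ofPred_eq]
  constructor <;> rintro ⟨h1, h2, h3, h4, h5⟩ <;> refine ⟨h2, h1, h4, h3, by linarith⟩

lemma preimage_fiveRev_fiveT4 : fiveRev ⁻¹' fiveT4 = fiveT4 := by
  ext z
  simp only [fiveRev, fiveT4, Set.mem_preimage, Set.mem_ofPred_eq]
  constructor <;> rintro ⟨h1, h2, h3, h4, h5⟩ <;> refine ⟨h4, h3, h2, h1, by linarith⟩

lemma fiveZ5_fiveSwap (z) : fiveZ5 (fiveSwap z) = fiveZ5 z := by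
  simp only [fiveSwap, fiveZ5]; ring

lemma fiveZ5_fiveRev (z) : fiveZ5 (fiveRev z) = fiveZ5 z := by
  simp only [fiveRev, fiveZ5]; ring

lemma fiveU_fiveSwap (z) : fiveU (fiveSwap z) = fiveU z := by
  simp only [fiveU, fiveZ5_fiveSwap]; simp only [fiveSwap]; ring

lemma fiveU_fiveRev (z) : fiveU (fiveRev z) = fiveU z := by
  simp only [fiveU, fiveZ5_fiveRev]; simp only [fiveRev]; ring

lemma fiveC_fiveSwap (z) : fiveC (fiveSwap z) = fiveC z := by
  simp only [fiveC, fiveZ5_fiveSwap]; simp only [fiveSwap]; ring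

lemma fiveC_fiveRev (z) : fiveC (fiveRev z) = fiveC z := by
  simp only [fiveC, fiveZ5_fiveRev]; simp only [fiveRev]; ring

end Symmetry

section Integrability

lemma measurableSet_fiveT4 : MeasurableSet fiveT4 := by
  unfold fiveT4
  measurability

lemma measurable_fiveZ5 : Measurable fiveZ5 := by
  unfold fiveZ5; fun_prop

lemma measurable_fiveU : Measurable fiveU := by
  have := measurable_fiveZ5
  unfold fiveU; fun_prop

lemma measurable_fiveC : Measurable fiveC := by
  have := measurable_fiveZ5
  unfold fiveC; fun_prop

lemma fiveZ5_pos {z : ℝ × ℝ × ℝ × ℝ} (hz : z ∈ fiveT4) : 0 < fiveZ5 z := by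
  have := hz.2.2.2.2
  unfold fiveZ5; linarith

lemma fiveU_pos {z : ℝ × ℝ × ℝ × ℝ} (hz : z ∈ fiveT4) : 0 < fiveU z := by
  have h5 := fiveZ5_pos hz
  obtain ⟨h1, h2, h3, h4, -⟩ := hz
  unfold fiveU; positivity

lemma fiveC_pos {z : ℝ × ℝ × ℝ × ℝ} (hz : z ∈ fiveT4) : 0 < fiveC z := by
  have h5 := fiveZ5_pos hz
  obtain ⟨h1, h2, h3, h4, -⟩ := hz
  unfold fiveC; positivity

/-- The function `x ^ (-5/6)` on `(0, 1)`, extended by zero. -/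
noncomputable def fiveRoot : ℝ → ℝ := (Set.Ioo 0 1).indicator fun x => x ^ (-(5 : ℝ) / 6)

/-- The product of the functions `fiveRoot` in the four variables. -/
noncomputable def fiveBound (z : ℝ × ℝ × ℝ × ℝ) : ℝ :=
  fiveRoot z.1 * (fiveRoot z.2.1 * (fiveRoot z.2.2.1 * fiveRoot z.2.2.2))

lemma integrable_fiveRoot : Integrable fiveRoot := by
  refine IntegrableOn.integrable_indicator ?_ measurableSet_Ioo
  exact (intervalIntegral.integrableOn_Ioo_rpow_iff one_pos).2 (by norm_num)

lemma integrable_fiveBound : Integrable fiveBound :=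
  integrable_fiveRoot.mul_prod
    (integrable_fiveRoot.mul_prod (integrable_fiveRoot.mul_prod integrable_fiveRoot))

lemma fiveRoot_nonneg (x : ℝ) : 0 ≤ fiveRoot x :=
  Set.indicator_nonneg (fun _ hx => Real.rpow_nonneg hx.1.le _) x

lemma fiveBound_nonneg (z) : 0 ≤ fiveBound z :=
  mul_nonneg (fiveRoot_nonneg _) (mul_nonneg (fiveRoot_nonneg _)
    (mul_nonneg (fiveRoot_nonneg _) (fiveRoot_nonneg _)))

lemma fiveBound_eq_exp {a b c d : ℝ} (ha : a ∈ Set.Ioo (0 : ℝ) 1) (hb : b ∈ Set.Ioo (0 : ℝ) 1)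
    (hc : c ∈ Set.Ioo (0 : ℝ) 1) (hd : d ∈ Set.Ioo (0 : ℝ) 1) :
    fiveBound (a, b, c, d) =
      Real.exp (-(5 / 6) * (Real.log a + Real.log b + Real.log c + Real.log d)) := by
  simp only [fiveBound, fiveRoot, Set.indicator_of_mem ha, Set.indicator_of_mem hb,
    Set.indicator_of_mem hc, Set.indicator_of_mem hd, Real.rpow_def_of_pos ha.1,
    Real.rpow_def_of_pos hb.1, Real.rpow_def_of_pos hc.1, Real.rpow_def_of_pos hd.1,
    ← Real.exp_add]
  congr 1; ring

lemma log_le_of_div_five_le {x y : ℝ} (hx : 0 < x) (h : x / 5 ≤ y) :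
    Real.log x - Real.log 5 ≤ Real.log y := by
  rw [← Real.log_div hx.ne' (by norm_num)]
  exact Real.log_le_log (by positivity) h

lemma log_add_log_le_of_mul_div_five_le {x y w : ℝ} (hx : 0 < x) (hy : 0 < y)
    (h : x * y / 5 ≤ w) : Real.log x + Real.log y - Real.log 5 ≤ Real.log w := by
  rw [← Real.log_mul hx.ne' hy.ne']
  exact log_le_of_div_five_le (mul_pos hx hy) h

lemma integrand_eq_exp {z : ℝ × ℝ × ℝ × ℝ} (hz : z ∈ fiveT4) (ε : ℝ) :
    fiveU z ^ (3 * ε - 1) * fiveC z ^ (-(1 + 2 * ε)) =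
      Real.exp (-(1 - 3 * ε) * Real.log (fiveU z) - (1 + 2 * ε) * Real.log (fiveC z)) := by
  rw [Real.rpow_def_of_pos (fiveU_pos hz), Real.rpow_def_of_pos (fiveC_pos hz), ← Real.exp_add]
  congr 1; ring

lemma integrand_le_of_fiveZ5 {ε : ℝ} (hε : ε ∈ Set.Ioo (-(1 : ℝ) / 6) (1 / 6))
    {z : ℝ × ℝ × ℝ × ℝ} (hz : z ∈ fiveT4) (h : 1 / 5 ≤ fiveZ5 z) :
    fiveU z ^ (3 * ε - 1) * fiveC z ^ (-(1 + 2 * ε)) ≤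
      Real.exp ((2 - ε) * Real.log 5) * fiveBound z := by
  rw [integrand_eq_exp hz]
  have hlt := hz.2.2.2.2
  obtain ⟨a, b, c, d⟩ := z
  obtain ⟨h1, h2, h3, h4, -⟩ := id hz
  obtain ⟨hε1, hε2⟩ := hε
  dsimp only at h1 h2 h3 h4 hlt
  rw [fiveBound_eq_exp ⟨h1, by linarith⟩ ⟨h2, by linarith⟩ ⟨h3, by linarith⟩
    ⟨h4, by linarith⟩, ← Real.exp_add, Real.exp_le_exp]
  have hU : (a + b + c + d) / 5 ≤ fiveU (a, b, c, d) := by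
    have : 1 / 5 * (a + b + c + d) ≤ fiveZ5 (a, b, c, d) * (a + b + c + d) := by gcongr
    have : 0 < (a + b) * (c + d) := by positivity
    simp only [fiveU]; linarith
  have hC : (a + c) * (b + d) / 5 ≤ fiveC (a, b, c, d) := by
    have : 1 / 5 * ((a + c) * (b + d)) ≤ fiveZ5 (a, b, c, d) * ((a + c) * (b + d)) := by gcongr
    have : 0 < a * b * c + a * b * d + a * c * d + b * c * d := by positivity
    simp only [fiveC]; linarith
  have hab := mul_pos h1 h2
  have hcb := mul_pos h3 h2
  have had := mul_pos h1 h4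
  have hcd := mul_pos h3 h4
  have u1 := log_le_of_div_five_le (y := fiveU (a, b, c, d)) h1 (by linarith)
  have u2 := log_le_of_div_five_le (y := fiveU (a, b, c, d)) h2 (by linarith)
  have u3 := log_le_of_div_five_le (y := fiveU (a, b, c, d)) h3 (by linarith)
  have u4 := log_le_of_div_five_le (y := fiveU (a, b, c, d)) h4 (by linarith)
  have c1 := log_add_log_le_of_mul_div_five_le (w := fiveC (a, b, c, d)) h1 h2 (by linarith)
  have c2 := log_add_log_le_of_mul_div_five_le (w := fiveC (a, b, c, d)) h3 h4 (by linarith)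
  have la := Real.log_nonpos h1.le (by linarith)
  have lb := Real.log_nonpos h2.le (by linarith)
  have lc := Real.log_nonpos h3.le (by linarith)
  have ld := Real.log_nonpos h4.le (by linarith)
  have hu := mul_le_mul_of_nonneg_left (add_le_add (add_le_add u1 u2) (add_le_add u3 u4))
    (by linarith : 0 ≤ (1 - 3 * ε) / 4)
  have hc := mul_le_mul_of_nonneg_left (add_le_add c1 c2) (by linarith : 0 ≤ (1 + 2 * ε) / 2)
  have hl := mul_nonpos_of_nonneg_of_nonpos (by linarith : 0 ≤ 1 / 12 - ε / 4)
    (by linarith : Real.log a + Real.log b + Real.log c + Real.log d ≤ 0)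
  linarith

lemma integrand_le_of_fst {ε : ℝ} (hε : ε ∈ Set.Ioo (-(1 : ℝ) / 6) (1 / 6))
    {z : ℝ × ℝ × ℝ × ℝ} (hz : z ∈ fiveT4) (h : 1 / 5 ≤ z.1) :
    fiveU z ^ (3 * ε - 1) * fiveC z ^ (-(1 + 2 * ε)) ≤
      Real.exp ((2 - ε) * Real.log 5) * fiveBound (fiveShear z) := by
  rw [integrand_eq_exp hz]
  have h5 := fiveZ5_pos hz
  obtain ⟨a, b, c, d⟩ := z
  obtain ⟨h1, h2, h3, h4, -⟩ := id hz
  obtain ⟨hε1, hε2⟩ := hε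
  have hsum : fiveZ5 (a, b, c, d) = 1 - a - b - c - d := rfl
  simp only [fiveShear, fiveU, fiveC] at h h1 h2 h3 h4 ⊢
  generalize fiveZ5 (a, b, c, d) = e at *
  rw [fiveBound_eq_exp ⟨h5, by linarith⟩ ⟨h2, by linarith⟩ ⟨h3, by linarith⟩
    ⟨h4, by linarith⟩, ← Real.exp_add, Real.exp_le_exp]
  have hU : (c + d + e) / 5 ≤ (a + b) * (c + d) + e * (a + b + c + d) := by
    have : 1 / 5 * (c + d + e) ≤ a * (c + d + e) := by gcongr
    have : 0 < b * (c + d) + e * (b + c + d) := by positivity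
    linarith
  have hC : (b + d) * (c + e) / 5 ≤ a * b * c + a * b * d + a * c * d + b * c * d +
      a * b * e + b * c * e + c * d * e + a * d * e := by
    have : 1 / 5 * ((b + d) * (c + e)) ≤ a * ((b + d) * (c + e)) := by gcongr
    have : 0 < a * b * d + b * c * d + b * c * e + c * d * e := by positivity
    linarith
  have hbc := mul_pos h2 h3
  have hbe := mul_pos h2 h5
  have hdc := mul_pos h4 h3
  have hde := mul_pos h4 h5
  generalize (a + b) * (c + d) + e * (a + b + c + d) = U at *
  generalize a * b * c + a * b * d + a * c * d + b * c * d +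
      a * b * e + b * c * e + c * d * e + a * d * e = C at *
  have u1 := log_le_of_div_five_le (y := U) h3 (by linarith)
  have u2 := log_le_of_div_five_le (y := U) h4 (by linarith)
  have u3 := log_le_of_div_five_le (y := U) h5 (by linarith)
  have c1 := log_add_log_le_of_mul_div_five_le (w := C) h2 h3 (by linarith)
  have c2 := log_add_log_le_of_mul_div_five_le (w := C) h4 h5 (by linarith)
  have lb := Real.log_nonpos h2.le (by linarith)
  have hu := mul_le_mul_of_nonneg_left (add_le_add (add_le_add u1 u2) u3)
    (by linarith : 0 ≤ (1 - 3 * ε) / 3)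
  have hc := mul_le_mul_of_nonneg_left (add_le_add c1 c2) (by linarith : 0 ≤ (1 + 2 * ε) / 2)
  have hl := mul_nonpos_of_nonneg_of_nonpos (by linarith : 0 ≤ 1 / 3 - ε) lb
  linarith

lemma integrand_le {ε : ℝ} (hε : ε ∈ Set.Ioo (-(1 : ℝ) / 6) (1 / 6))
    {z : ℝ × ℝ × ℝ × ℝ} (hz : z ∈ fiveT4) :
    fiveU z ^ (3 * ε - 1) * fiveC z ^ (-(1 + 2 * ε)) ≤ Real.exp ((2 - ε) * Real.log 5) *
      (fiveBound z + fiveBound (fiveShear z) + fiveBound (fiveShear (fiveSwap z)) +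
        fiveBound (fiveShear (fiveRev z)) + fiveBound (fiveShear (fiveSwap (fiveRev z)))) := by
  have n0 := fiveBound_nonneg z
  have n1 := fiveBound_nonneg (fiveShear z)
  have n2 := fiveBound_nonneg (fiveShear (fiveSwap z))
  have n3 := fiveBound_nonneg (fiveShear (fiveSwap (fiveRev z)))
  have n4 := fiveBound_nonneg (fiveShear (fiveRev z))
  have hswap : ∀ {w}, w ∈ fiveT4 → fiveSwap w ∈ fiveT4 := fun {w} hw =>
    (Set.ext_iff.1 preimage_fiveSwap_fiveT4 w).2 hw
  have hrev : fiveRev z ∈ fiveT4 := (Set.ext_iff.1 preimage_fiveRev_fiveT4 z).2 hz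
  by_cases h5 : 1 / 5 ≤ fiveZ5 z
  · exact (integrand_le_of_fiveZ5 hε hz h5).trans (by gcongr; linarith)
  by_cases h1 : 1 / 5 ≤ z.1
  · exact (integrand_le_of_fst hε hz h1).trans (by gcongr; linarith)
  by_cases h2 : 1 / 5 ≤ z.2.1
  · have := integrand_le_of_fst hε (hswap hz) h2
    rw [fiveU_fiveSwap, fiveC_fiveSwap] at this
    exact this.trans (by gcongr; linarith)
  by_cases h3 : 1 / 5 ≤ z.2.2.1
  · have := integrand_le_of_fst hε (hswap hrev) h3
    rw [fiveU_fiveSwap, fiveC_fiveSwap, fiveU_fiveRev, fiveC_fiveRev] at this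
    exact this.trans (by gcongr; linarith)
  have h4 : 1 / 5 ≤ z.2.2.2 := by
    simp only [fiveZ5, not_le] at h5 h1 h2 h3
    linarith
  have := integrand_le_of_fst hε hrev h4
  rw [fiveU_fiveRev, fiveC_fiveRev] at this
  exact this.trans (by gcongr; linarith)

lemma integrableOn_integrand {ε : ℝ} (hε : ε ∈ Set.Ioo (-(1 : ℝ) / 6) (1 / 6)) :
    IntegrableOn (fun z => fiveU z ^ (3 * ε - 1) * fiveC z ^ (-(1 + 2 * ε))) fiveT4 volume := by
  have i1 := measurePreserving_fiveShear.integrable_comp_of_integrable integrable_fiveBound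
  have i2 := measurePreserving_fiveSwap.integrable_comp_of_integrable i1
  have i3 := measurePreserving_fiveRev.integrable_comp_of_integrable i1
  have i4 := measurePreserving_fiveRev.integrable_comp_of_integrable i2
  have hg := ((((integrable_fiveBound.add i1).add i2).add i3).add i4).const_mul
    (Real.exp ((2 - ε) * Real.log 5))
  refine Integrable.mono' hg.integrableOn ?_ ?_
  · exact ((measurable_fiveU.pow_const _).mul (measurable_fiveC.pow_const _)).aestronglyMeasurable
  · refine (ae_restrict_iff' measurableSet_fiveT4).2 (Filter.Eventually.of_forall fun z hz => ?_)
    rw [Real.norm_of_nonneg (mul_nonneg (Real.rpow_nonneg (fiveU_pos hz).le _)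
      (Real.rpow_nonneg (fiveC_pos hz).le _))]
    exact integrand_le hε hz

lemma fiveU_rpow {z : ℝ × ℝ × ℝ × ℝ} (hz : z ∈ fiveT4) (ε : ℝ) :
    fiveU z ^ (3 * ε - 1) = fiveU z * fiveU z ^ (3 * ε - 2) := by
  rw [mul_comm (fiveU z), ← Real.rpow_add_one (fiveU_pos hz).ne']
  congr 1; ring

lemma integrableOn_mul_integrand {ε : ℝ} (hε : ε ∈ Set.Ioo (-(1 : ℝ) / 6) (1 / 6))
    {m : ℝ × ℝ × ℝ × ℝ → ℝ} (hm : Measurable m)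
    (hmU : ∀ z ∈ fiveT4, 0 ≤ m z ∧ m z ≤ fiveU z) :
    IntegrableOn (fun z => m z * fiveU z ^ (3 * ε - 2) * fiveC z ^ (-(1 + 2 * ε)))
      fiveT4 volume := by
  refine Integrable.mono' (integrableOn_integrand hε) ?_ ?_
  · exact ((hm.mul (measurable_fiveU.pow_const _)).mul
      (measurable_fiveC.pow_const _)).aestronglyMeasurable
  · refine (ae_restrict_iff' measurableSet_fiveT4).2 (Filter.Eventually.of_forall fun z hz => ?_)
    have hU := Real.rpow_nonneg (fiveU_pos hz).le (3 * ε - 2)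
    have hC := Real.rpow_nonneg (fiveC_pos hz).le (-(1 + 2 * ε))
    obtain ⟨h0, h1⟩ := hmU z hz
    rw [Real.norm_of_nonneg (by positivity), fiveU_rpow hz]
    gcongr

end Integrability

/-- The symmetry sum rule for the two-loop five-edge two-point diagram:
`I(1,1,1,1,1;−1+3ε) = 2 I(2,1,2,1,1;−2+3ε) + 2 I(2,1,1,2,1;−2+3ε) + 4 I(2,1,1,1,2;−2+3ε)`. -/
theorem five_edge_sum_rule (ε : ℝ) (hε : ε ∈ Set.Ioo (-(1 : ℝ) / 6) (1 / 6)) :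
    IntegrableOn (fun z => fiveU z ^ (3 * ε - 1) * fiveC z ^ (-(1 + 2 * ε))) fiveT4 volume ∧
    IntegrableOn (fun z => z.1 * z.2.2.1 * fiveU z ^ (3 * ε - 2) * fiveC z ^ (-(1 + 2 * ε)))
      fiveT4 volume ∧
    IntegrableOn (fun z => z.1 * z.2.2.2 * fiveU z ^ (3 * ε - 2) * fiveC z ^ (-(1 + 2 * ε)))
      fiveT4 volume ∧
    IntegrableOn (fun z => z.1 * fiveZ5 z * fiveU z ^ (3 * ε - 2) * fiveC z ^ (-(1 + 2 * ε)))
      fiveT4 volume ∧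
    ∫ z in fiveT4, fiveU z ^ (3 * ε - 1) * fiveC z ^ (-(1 + 2 * ε)) =
      2 * (∫ z in fiveT4, z.1 * z.2.2.1 * fiveU z ^ (3 * ε - 2) * fiveC z ^ (-(1 + 2 * ε)))
        + 2 * (∫ z in fiveT4, z.1 * z.2.2.2 * fiveU z ^ (3 * ε - 2) * fiveC z ^ (-(1 + 2 * ε)))
        + 4 * ∫ z in fiveT4, z.1 * fiveZ5 z * fiveU z ^ (3 * ε - 2) * fiveC z ^ (-(1 + 2 * ε)) := by
  have i13 : IntegrableOn (fun z => z.1 * z.2.2.1 * fiveU z ^ (3 * ε - 2) *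
      fiveC z ^ (-(1 + 2 * ε))) fiveT4 volume :=
    integrableOn_mul_integrand hε (by fun_prop) fun z hz => by
      have h5 := fiveZ5_pos hz
      obtain ⟨h1, h2, h3, h4, -⟩ := hz
      refine ⟨by positivity, sub_nonneg.1 ?_⟩
      unfold fiveU; ring_nf; positivity
  have i14 : IntegrableOn (fun z => z.1 * z.2.2.2 * fiveU z ^ (3 * ε - 2) *
      fiveC z ^ (-(1 + 2 * ε))) fiveT4 volume :=
    integrableOn_mul_integrand hε (by fun_prop) fun z hz => by
      have h5 := fiveZ5_pos hz
      obtain ⟨h1, h2, h3, h4, -⟩ := hz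
      refine ⟨by positivity, sub_nonneg.1 ?_⟩
      unfold fiveU; ring_nf; positivity
  have i15 : IntegrableOn (fun z => z.1 * fiveZ5 z * fiveU z ^ (3 * ε - 2) *
      fiveC z ^ (-(1 + 2 * ε))) fiveT4 volume :=
    integrableOn_mul_integrand hε (measurable_fst.mul measurable_fiveZ5) fun z hz => by
      have h5 := fiveZ5_pos hz
      obtain ⟨h1, h2, h3, h4, -⟩ := hz
      refine ⟨by positivity, sub_nonneg.1 ?_⟩
      unfold fiveU; ring_nf; positivity
  refine ⟨integrableOn_integrand hε, i13, i14, i15, ?_⟩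
  have hswap := fun {f} => setIntegral_add_comp_of_involutive (f := f) measurePreserving_fiveSwap
    fiveSwap_involutive measurableSet_fiveT4 preimage_fiveSwap_fiveT4
  obtain ⟨j13, e13⟩ := hswap i13
  obtain ⟨j14, e14⟩ := hswap i14
  obtain ⟨j15, e15⟩ := hswap i15
  obtain ⟨k15, e15'⟩ := setIntegral_add_comp_of_involutive measurePreserving_fiveRev
    fiveRev_involutive measurableSet_fiveT4 preimage_fiveRev_fiveT4 j15
  rw [e15] at e15'
  rw [← e13, ← e14, show ∀ x : ℝ, 4 * x = 2 * (2 * x) by intro x; ring, ← e15',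
    ← integral_add j13 j14]
  refine Eq.trans ?_ (integral_add (j13.add j14) k15)
  refine setIntegral_congr_fun measurableSet_fiveT4 fun z hz => ?_
  simp only [fiveU_fiveSwap, fiveC_fiveSwap, fiveZ5_fiveSwap, fiveU_fiveRev,
    fiveC_fiveRev, fiveZ5_fiveRev, fiveU_rpow hz]
  rw [show fiveU z = z.1 * z.2.2.1 + z.2.1 * z.2.2.2 + (z.1 * z.2.2.2 + z.2.1 * z.2.2.1) +
    (z.1 + z.2.1 + (z.2.2.2 + z.2.2.1)) * fiveZ5 z by unfold fiveU; ring]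
  simp only [fiveSwap, fiveRev]
  ring
end
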